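/- arXiv:2402.18676 — 2 statements merged into one kernel-verified Lean document; each statement's English description precedes it below -/
import Mathlib

section
/- Let F be a totally real number field of degree d over ℚ, given with a fixed embedding F ⊆ ℝ. Let x and y be elements of the ring of integers of F such that for every field embedding φ : F → ℝ different from the fixed one, |φ(x)| ≤ 2 and |φ(y)| ≤ 2. If x ≠ y, then |x − y| ≥ 4^(1−d). -/
/-- A nonzero algebraic integer of a number field has norm of absolute value at least one,
expressed as a product over the complex embeddings. -/
theorem one_le_prod_norm_embeddings {F : Type*} [Field F] [NumberField F] {z : F}
    (hz : IsIntegral ℤ z) (hz0 : z ≠ 0) :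
    1 ≤ ∏ σ : F →ₐ[ℚ] ℂ, ‖σ z‖ := by
  obtain ⟨n, hn⟩ := IsIntegrallyClosed.isIntegral_iff.1 (Algebra.isIntegral_norm ℚ hz)
  have hn0 : n ≠ 0 := by
    rintro rfl
    exact (Algebra.norm_ne_zero_iff (R := ℚ)).mpr hz0 (by rw [← hn, map_zero])
  rw [← norm_prod, ← Algebra.norm_eq_prod_embeddings ℚ ℂ z, ← hn]
  simpa using mod_cast Int.one_le_abs hn0

/-- A ring homomorphism to `ℂ` with real values factors through `ℝ`. -/
theorem exists_ofRealHom_comp_eq {F : Type*} [Field F] (φ : F →+* ℂ)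
    (hφ : ∀ a, (φ a).im = 0) : ∃ ψ : F →+* ℝ, Complex.ofRealHom.comp ψ = φ := by
  refine ⟨{ toFun := fun a => (φ a).re
            map_one' := by simp
            map_mul' := fun a b => by simp [hφ]
            map_zero' := by simp
            map_add' := fun a b => by simp }, ?_⟩
  ext a
  apply Complex.ext <;> simp [hφ]

/-- **Minimal spacing for totally real fields** (Lemma 4.1, after Luo–Sarnak).
Let `F` be a totally real number field of degree `d` over `ℚ`, with a fixed real
embedding `ι : F →+* ℝ`.  If `x, y` are algebraic integers of `F` such that every
real embedding of `F` different from `ι` maps both `x` and `y` into `[-2, 2]`,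
and `x ≠ y`, then `|ι x - ι y| ≥ 4 ^ (1 - d)`. -/
theorem minimal_spacing_totally_real
    (F : Type*) [Field F] [NumberField F] (d : ℕ)
    (hd : Module.finrank ℚ F = d)
    (htotallyReal : ∀ φ : F →+* ℂ, ∀ a : F, (φ a).im = 0)
    (ι : F →+* ℝ) (x y : F)
    (hx : IsIntegral ℤ x) (hy : IsIntegral ℤ y)
    (hbx : ∀ φ : F →+* ℝ, φ ≠ ι → |φ x| ≤ 2)
    (hby : ∀ φ : F →+* ℝ, φ ≠ ι → |φ y| ≤ 2)
    (hxy : x ≠ y) :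
    (4 : ℝ) ^ ((1 : ℤ) - (d : ℤ)) ≤ |ι x - ι y| := by
  classical
  let τ : F →ₐ[ℚ] ℂ := (Complex.ofRealHom.comp ι).toRatAlgHom
  have h_other : ∀ σ ∈ Finset.univ.erase τ, ‖σ (x - y)‖ ≤ 4 := by
    intro σ hσ
    obtain ⟨ψ, hψ⟩ := exists_ofRealHom_comp_eq (σ : F →+* ℂ) (htotallyReal σ)
    have hne : ψ ≠ ι := by
      rintro rfl
      exact (Finset.ne_of_mem_erase hσ) (AlgHom.ext fun a => (DFunLike.congr_fun hψ a).symm)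
    have hval : σ (x - y) = ((ψ (x - y) : ℝ) : ℂ) := (DFunLike.congr_fun hψ (x - y)).symm
    rw [hval, Complex.norm_real, Real.norm_eq_abs, map_sub]
    linarith [abs_sub (ψ x) (ψ y), hbx ψ hne, hby ψ hne]
  have hτ : ‖τ (x - y)‖ = |ι x - ι y| := by
    change ‖((ι (x - y) : ℝ) : ℂ)‖ = _
    rw [Complex.norm_real, Real.norm_eq_abs, map_sub]
  have hcard : (Finset.univ.erase τ).card = d - 1 := by
    rw [Finset.card_erase_of_mem (Finset.mem_univ τ), Finset.card_univ, AlgHom.card, hd]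
  have hd1 : 1 ≤ d := hd ▸ Module.finrank_pos
  have hprod := one_le_prod_norm_embeddings (hx.sub hy) (sub_ne_zero.mpr hxy)
  rw [← Finset.mul_prod_erase _ _ (Finset.mem_univ τ), hτ] at hprod
  have hle : ∏ σ ∈ Finset.univ.erase τ, ‖σ (x - y)‖ ≤ 4 ^ (d - 1) := by
    rw [← hcard, ← Finset.prod_const]
    exact Finset.prod_le_prod (fun _ _ => norm_nonneg _) h_other
  have hexp : (1 : ℤ) - d = -((d - 1 : ℕ) : ℤ) := by omega
  rw [hexp, zpow_neg, zpow_natCast, inv_le_iff_one_le_mul₀ (by positivity)]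
  exact hprod.trans (mul_le_mul_of_nonneg_left hle (abs_nonneg _))
end

section
/- For all real numbers u, v, M with 4 < u ≤ M and 4 < v ≤ M, one has |log(arcosh((u−2)/2)) − log(arcosh((v−2)/2))| ≥ |u − v|/M². -/
/-- The inverse hyperbolic cosine `arcosh : [1, ∞) → [0, ∞)`,
given by the formula `arcosh x = log (x + √(x² - 1))`. -/
noncomputable def arcosh (x : ℝ) : ℝ := Real.log (x + Real.sqrt (x ^ 2 - 1))

theorem sqrt_sq_sub_one_le {y : ℝ} (hy : 0 ≤ y) : √(y ^ 2 - 1) ≤ y :=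
  Real.sqrt_le_iff.mpr ⟨hy, by linarith⟩

theorem arcosh_le_two_mul_sub_one {y : ℝ} (hy : 1 ≤ y) : arcosh y ≤ 2 * y - 1 := by
  have hs := sqrt_sq_sub_one_le (zero_le_one.trans hy)
  have hpos : 0 < y + √(y ^ 2 - 1) := by positivity
  have hlog := Real.log_le_sub_one_of_pos hpos
  unfold arcosh
  linarith

theorem hasDerivAt_arcosh {y : ℝ} (hy : 1 < y) : HasDerivAt arcosh (√(y ^ 2 - 1))⁻¹ y :=
  Real.hasDerivAt_arcosh hy

theorem hasDerivAt_log_arcosh {x : ℝ} (hx : 4 < x) :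
    HasDerivAt (fun t => Real.log (arcosh ((t - 2) / 2)))
      (1 / (2 * √(((x - 2) / 2) ^ 2 - 1) * arcosh ((x - 2) / 2))) x := by
  have hy : 1 < (x - 2) / 2 := by linarith
  have hlin : HasDerivAt (fun t : ℝ => (t - 2) / 2) (1 / 2) x :=
    ((hasDerivAt_id x).sub_const 2).div_const 2
  have harcosh : HasDerivAt (fun t => arcosh ((t - 2) / 2))
      ((√(((x - 2) / 2) ^ 2 - 1))⁻¹ * (1 / 2)) x :=
    HasDerivAt.comp (h₂ := arcosh) x (hasDerivAt_arcosh hy) hlin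
  convert harcosh.log (Real.arcosh_pos hy).ne' using 1
  ring

theorem one_div_sq_le_deriv_log_arcosh {x : ℝ} (hx : 4 < x) :
    1 / x ^ 2 ≤ deriv (fun t => Real.log (arcosh ((t - 2) / 2))) x := by
  have hy : 1 < (x - 2) / 2 := by linarith
  rw [(hasDerivAt_log_arcosh hx).deriv]
  have hpos : 0 < arcosh ((x - 2) / 2) := Real.arcosh_pos hy
  have hsqrt : 0 < √(((x - 2) / 2) ^ 2 - 1) := Real.sqrt_pos.mpr (by nlinarith)
  have hs := sqrt_sq_sub_one_le (zero_le_one.trans hy.le)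
  have ha := arcosh_le_two_mul_sub_one hy.le
  rw [sq x]
  gcongr <;> linarith

theorem sub_div_sq_le_log_arcosh_sub {u v M : ℝ} (hv : 4 < v) (hvu : v ≤ u) (huM : u ≤ M) :
    (u - v) / M ^ 2 ≤
      Real.log (arcosh ((u - 2) / 2)) - Real.log (arcosh ((v - 2) / 2)) := by
  have hdiff (x : ℝ) (hx : x ∈ Set.Icc v u) :
      DifferentiableAt ℝ (fun t => Real.log (arcosh ((t - 2) / 2))) x :=
    (hasDerivAt_log_arcosh (hv.trans_le hx.1)).differentiableAt
  have hmvt := (convex_Icc v u).mul_sub_le_image_sub_of_le_deriv (C := 1 / M ^ 2)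
    (fun x hx => (hdiff x hx).continuousAt.continuousWithinAt)
    (fun x hx => (hdiff x (interior_subset hx)).differentiableWithinAt)
    (fun x hx => by
      obtain ⟨hvx, hxu⟩ := interior_subset hx
      have hx4 : 4 < x := hv.trans_le hvx
      refine le_trans ?_ (one_div_sq_le_deriv_log_arcosh hx4)
      have hxM : x ≤ M := hxu.trans huM
      gcongr)
    v (Set.left_mem_Icc.mpr hvu) u (Set.right_mem_Icc.mpr hvu) hvu
  rwa [one_div_mul_eq_div] at hmvt

/-- **Mean-value-theorem step in the proof of Theorem 4.2**: for all reals
`4 < u ≤ M` and `4 < v ≤ M`,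
`|log(arcosh((u-2)/2)) - log(arcosh((v-2)/2))| ≥ |u - v| / M²`. -/
theorem log_arcosh_diff_lower_bound
    (u v M : ℝ) (hu : 4 < u) (huM : u ≤ M) (hv : 4 < v) (hvM : v ≤ M) :
    |u - v| / M ^ 2 ≤
      |Real.log (arcosh ((u - 2) / 2)) - Real.log (arcosh ((v - 2) / 2))| := by
  rcases le_total v u with h | h
  · rw [abs_of_nonneg (sub_nonneg.mpr h)]
    exact (sub_div_sq_le_log_arcosh_sub hv h huM).trans (le_abs_self _)
  · rw [abs_sub_comm u v, abs_of_nonneg (sub_nonneg.mpr h), abs_sub_comm]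
    exact (sub_div_sq_le_log_arcosh_sub hu h hvM).trans (le_abs_self _)
end
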